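/- Let N ~ N_d(0,I_d) be independent of A and set F_t := √Γ_t · N, and write M_t := Γ_t^{−1}(A−K). Then for every t ∈ [0,1]: (i) E[(h₁(A,t,F_t))²·1_E] = (1/2)·E[tr(M_t²)·1_E]; (ii) E[(h₁(A,t,F_t))⁴·1_E] = 3·E[tr(M_t⁴)·1_E] + (3/4)·E[(tr(M_t²))²·1_E]; (iii) E[(h₁(A,t,F_t))⁶·1_E] = 60·E[tr(M_t⁶)·1_E] + (15/8)·E[(tr(M_t²))³·1_E] + 10·E[(tr(M_t³))²·1_E] + (45/2)·E[tr(M_t²)·tr(M_t⁴)·1_E]. -/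

import Mathlib

open MeasureTheory ProbabilityTheory Matrix

noncomputable section

/-- Euclidean norm on `Fin d → ℝ`. -/
def euclNorm {d : ℕ} (x : Fin d → ℝ) : ℝ := Real.sqrt (∑ i, x i ^ 2)

/-- Hilbert–Schmidt norm of a matrix. -/
def hsNorm {d : ℕ} (M : Matrix (Fin d) (Fin d) ℝ) : ℝ := Real.sqrt (∑ i, ∑ j, M i j ^ 2)

/-- Operator norm of a matrix (w.r.t. the Euclidean norm). -/
def opNorm {d : ℕ} (M : Matrix (Fin d) (Fin d) ℝ) : ℝ :=
  sSup {r : ℝ | ∃ x : Fin d → ℝ, euclNorm x = 1 ∧ r = euclNorm (M.mulVec x)}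

/-- Smallest eigenvalue of a symmetric matrix (as the infimum of the Rayleigh quotient). -/
def lambdaMin {d : ℕ} (M : Matrix (Fin d) (Fin d) ℝ) : ℝ :=
  sInf {r : ℝ | ∃ x : Fin d → ℝ, euclNorm x = 1 ∧ r = x ⬝ᵥ M.mulVec x}

/-- Density of the centered Gaussian law `N_d(0, M)` on `ℝ^d`. -/
def gaussDensity {d : ℕ} (M : Matrix (Fin d) (Fin d) ℝ) (x : Fin d → ℝ) : ℝ :=
  (Real.sqrt ((2 * Real.pi) ^ d * M.det))⁻¹ * Real.exp (-(1/2) * (x ⬝ᵥ M⁻¹.mulVec x))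

/-- The centered Gaussian law `N_d(0, M)` on `ℝ^d` (for `M` positive definite). -/
def gaussLaw {d : ℕ} (M : Matrix (Fin d) (Fin d) ℝ) : Measure (Fin d → ℝ) :=
  volume.withDensity fun x => ENNReal.ofReal (gaussDensity M x)

/-- Relative entropy (Kullback–Leibler divergence) of `μ` with respect to `ν`. -/
def relEnt {E : Type*} [MeasurableSpace E] (μ ν : Measure E) : ℝ :=
  ∫ x, Real.log ((μ.rnDeriv ν x).toReal) ∂μ

/-- `F` is a centered, integrable random vector which is conditionally Gaussian with respect to
the σ-field `𝓕`, with conditional covariance matrix `A`. -/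
def CondGaussian {Ω : Type*} [MeasurableSpace Ω] (P : Measure Ω) {d : ℕ}
    (F : Ω → Fin d → ℝ) (𝓕 : MeasurableSpace Ω)
    (A : Ω → Matrix (Fin d) (Fin d) ℝ) : Prop :=
  Integrable F P ∧ (∫ ω, F ω ∂P) = 0 ∧
  (∀ ω, (A ω).PosSemidef) ∧
  Measurable[𝓕] (fun ω i j => A ω i j) ∧
  ∀ y : Fin d → ℝ,
    P[(fun ω => Complex.exp (Complex.I * ((y ⬝ᵥ F ω : ℝ) : ℂ))) | 𝓕] =ᵐ[P]
      fun ω => ((Real.exp (-(1/2) * (y ⬝ᵥ (A ω).mulVec y)) : ℝ) : ℂ)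

/-- The dimensional constant `2√6 + 3√2 + 2 + √d`. -/
def Cfac (d : ℕ) : ℝ := 2 * Real.sqrt 6 + 3 * Real.sqrt 2 + 2 + Real.sqrt d

/-- `max{ |log(2^d det K/(2‖K‖_op + λ(K))^d)| , log(2^d det K/λ(K)^d) }`. -/
def maxLog {d : ℕ} (K : Matrix (Fin d) (Fin d) ℝ) : ℝ :=
  max |Real.log ((2 ^ d * K.det) / ((2 * opNorm K + lambdaMin K) ^ d))|
      (Real.log ((2 ^ d * K.det) / (lambdaMin K ^ d)))


/-- The event `E = {‖A − K‖_op ≤ λ(K)/2}`. -/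
def EvSet {Ω : Type*} {d : ℕ} (A : Ω → Matrix (Fin d) (Fin d) ℝ)
    (K : Matrix (Fin d) (Fin d) ℝ) : Set Ω :=
  {ω | opNorm (A ω - K) ≤ lambdaMin K / 2}


/-- The interpolating matrix `Γ_t = tA + (1−t)K`. -/
def Gam {d : ℕ} (A K : Matrix (Fin d) (Fin d) ℝ) (t : ℝ) : Matrix (Fin d) (Fin d) ℝ :=
  t • A + (1 - t) • K

/-- The interpolating density ratio `g(A,t,x) = φ_{Γ_t}(x)/φ_K(x)`. -/
def gfun {d : ℕ} (A K : Matrix (Fin d) (Fin d) ℝ) (t : ℝ) (x : Fin d → ℝ) : ℝ :=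
  gaussDensity (Gam A K t) x / gaussDensity K x

/-- `h_k(A,t,x) = (∂^k g/∂t^k)(A,t,x) / g(A,t,x)`. -/
def hfun {d : ℕ} (k : ℕ) (A K : Matrix (Fin d) (Fin d) ℝ) (t : ℝ) (x : Fin d → ℝ) : ℝ :=
  iteratedDeriv k (fun s => gfun A K s x) t / gfun A K t x

/-- `g̃(A,t,x) = E[φ_{Γ_t}(x) 1_E] / (P(E) φ_K(x))`. -/
def gtilde {Ω : Type*} [MeasurableSpace Ω] (P : Measure Ω) {d : ℕ}
    (A : Ω → Matrix (Fin d) (Fin d) ℝ) (K : Matrix (Fin d) (Fin d) ℝ)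
    (t : ℝ) (x : Fin d → ℝ) : ℝ :=
  (∫ ω in EvSet A K, gaussDensity (Gam (A ω) K t) x ∂P) /
    ((P (EvSet A K)).toReal * gaussDensity K x)

end


lemma gm_aux (k : ℕ) : ∫ x, x ^ (2 * k) ∂(gaussianReal 0 1) = ((2 * k - 1 : ℕ).doubleFactorial : ℝ) := by
  rw [integral_gaussianReal_eq_integral_smul (by simp)]
  have h1 : (fun x : ℝ => gaussianPDFReal 0 1 x • x ^ (2 * k)) =
      fun x : ℝ => (fun y : ℝ => (√(2 * Real.pi))⁻¹ * (y ^ (2 * k) * Real.exp (-(1/2) * y ^ 2))) |x| := by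
    funext x
    simp only [gaussianPDFReal, smul_eq_mul, NNReal.coe_one, sq_abs, (even_two_mul k).pow_abs]
    ring_nf
  rw [h1, integral_comp_abs (f := fun y : ℝ => (√(2 * Real.pi))⁻¹ * (y ^ (2 * k) * Real.exp (-(1/2) * y ^ 2))), integral_const_mul]
  have h2 := integral_rpow_mul_exp_neg_mul_rpow (p := 2) (q := (2 * k : ℕ)) (b := 1/2) (by norm_num)
    (by have : (0:ℝ) ≤ (2 * k : ℕ) := by positivity
        linarith) (by norm_num)
  simp only [Real.rpow_natCast, Real.rpow_two] at h2
  rw [h2]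
  have h3 : (((2 * k : ℕ) : ℝ) + 1) / 2 = k + 1 / 2 := by push_cast; ring
  rw [h3, Real.Gamma_nat_add_half]
  have h4 : -(((2 * k : ℕ) : ℝ) + 1) / 2 = -(k + 1 / 2) := by push_cast; ring
  rw [h4, Real.rpow_neg (by norm_num), Real.rpow_add (by norm_num), Real.rpow_natCast,
    ← Real.sqrt_eq_rpow]
  rw [Real.sqrt_mul (by norm_num), Real.sqrt_div (by norm_num)]
  simp only [Real.sqrt_one]
  have : √Real.pi ≠ 0 := by positivity
  have : √(2:ℝ) ≠ 0 := by positivity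
  field_simp
  rw [← mul_pow]
  norm_num

lemma gint (k : ℕ) : Integrable (fun x : ℝ => x ^ k) (gaussianReal 0 1) := by
  have := (memLp_id_gaussianReal (μ := 0) (v := 1) (k : NNReal)).integrable_norm_pow' 
  rw [← integrable_norm_iff (by fun_prop)]
  simpa using this

lemma zint (k : ℕ) : Integrable (fun x : ℝ => (x ^ 2 - 1) ^ k) (gaussianReal 0 1) := by
  have : (fun x : ℝ => (x ^ 2 - 1) ^ k) =
     fun x => ∑ m ∈ Finset.range (k+1), (x ^ (2 * m)) * ((-1 : ℝ) ^ (k - m) * (k.choose m)) := by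
    funext x
    rw [sub_eq_add_neg, add_pow]
    simp only [pow_mul, mul_assoc]
  rw [this]
  exact integrable_finsetSum _ fun m _ => (gint _).mul_const _

lemma zmom (k : ℕ) : ∫ x, (x ^ 2 - 1) ^ k ∂(gaussianReal 0 1) =
    ∑ m ∈ Finset.range (k+1), ((2 * m - 1 : ℕ).doubleFactorial : ℝ) * ((-1 : ℝ) ^ (k - m) * (k.choose m)) := by
  have : (fun x : ℝ => (x ^ 2 - 1) ^ k) =
     fun x => ∑ m ∈ Finset.range (k+1), (x ^ (2 * m)) * ((-1 : ℝ) ^ (k - m) * (k.choose m)) := by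
    funext x
    rw [sub_eq_add_neg, add_pow]
    simp only [pow_mul, mul_assoc]
  rw [this, integral_finsetSum _ fun m _ => (gint _).mul_const _]
  refine Finset.sum_congr rfl fun m _ => ?_
  rw [integral_mul_const, gm_aux]

lemma zmoms : ∫ x, (x ^ 2 - 1) ^ 1 ∂(gaussianReal 0 1) = 0 ∧
    ∫ x, (x ^ 2 - 1) ^ 2 ∂(gaussianReal 0 1) = 2 ∧
    ∫ x, (x ^ 2 - 1) ^ 3 ∂(gaussianReal 0 1) = 8 ∧
    ∫ x, (x ^ 2 - 1) ^ 4 ∂(gaussianReal 0 1) = 60 ∧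
    ∫ x, (x ^ 2 - 1) ^ 5 ∂(gaussianReal 0 1) = 544 ∧
    ∫ x, (x ^ 2 - 1) ^ 6 ∂(gaussianReal 0 1) = 6040 := by
  simp only [zmom]
  refine ⟨?_, ?_, ?_, ?_, ?_, ?_⟩ <;>
  norm_num [Finset.sum_range_succ, Nat.doubleFactorial, Nat.choose]

lemma gaussDensity_one {d : ℕ} (x : Fin d → ℝ) :
    gaussDensity (1 : Matrix (Fin d) (Fin d) ℝ) x = ∏ i, gaussianPDFReal 0 1 (x i) := by
  simp only [gaussDensity, gaussianPDFReal, inv_one, one_mulVec, dotProduct, det_one, mul_one,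
    NNReal.coe_one, sub_zero]
  rw [Finset.prod_mul_distrib, ← Real.exp_sum, Finset.prod_const, Finset.card_univ, Fintype.card_fin,
    inv_pow]
  congr 2
  · rw [← Real.sqrt_sq (show 0 ≤ √(2 * Real.pi) ^ d by positivity), ← pow_mul, mul_comm d, pow_mul,
      Real.sq_sqrt (by positivity)]
  · rw [Finset.mul_sum]
    exact Finset.sum_congr rfl fun i _ => by ring

lemma gaussLaw_one {d : ℕ} : gaussLaw (1 : Matrix (Fin d) (Fin d) ℝ) =
    Measure.pi (fun _ => gaussianReal 0 1) := by
  refine (Measure.pi_eq fun s hs => ?_).symm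
  have hm : MeasurableSet (Set.univ.pi s) := MeasurableSet.univ_pi hs
  have hi : ∀ i, Integrable ((s i).indicator (gaussianPDFReal 0 1)) volume :=
    fun i => (integrable_gaussianPDFReal 0 1).indicator (hs i)
  have hprod : (fun x : Fin d → ℝ => ∏ i, (s i).indicator (gaussianPDFReal 0 1) (x i)) =
      (Set.univ.pi s).indicator (gaussDensity 1) := by
    funext x
    by_cases hx : x ∈ Set.univ.pi s
    · rw [Set.indicator_of_mem hx, gaussDensity_one]
      exact Finset.prod_congr rfl fun i _ => Set.indicator_of_mem (hx i (Set.mem_univ i)) _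
    · rw [Set.indicator_of_notMem hx]
      simp only [Set.mem_univ_pi, not_forall] at hx
      obtain ⟨i, hi⟩ := hx
      exact Finset.prod_eq_zero (Finset.mem_univ i) (Set.indicator_of_notMem hi _)
  have hI : Integrable ((Set.univ.pi s).indicator (gaussDensity 1)) := by
    rw [← hprod]
    exact Integrable.fintype_prod hi
  rw [gaussLaw, withDensity_apply _ hm, ← ofReal_integral_eq_lintegral_ofReal,
    ← integral_indicator hm, ← hprod, integral_fintype_prod_volume_eq_prod,
    ENNReal.ofReal_prod_of_nonneg]
  · refine Finset.prod_congr rfl fun i _ => ?_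
    rw [gaussianReal_apply_eq_integral _ (by simp), integral_indicator (hs i)]
  · intro i _
    exact integral_nonneg fun x => Set.indicator_nonneg (fun _ _ => gaussianPDFReal_nonneg _ _ _) _
  · exact (integrable_indicator_iff hm).1 hI
  · exact ae_of_all _ fun x => by
      rw [gaussDensity_one]
      exact Finset.prod_nonneg fun i _ => gaussianPDFReal_nonneg _ _ _

/-- Moments (up to order six) of a centered variable, in terms of cumulants. -/
structure MomSix {Ω : Type*} [MeasurableSpace Ω] (P : Measure Ω) (T : Ω → ℝ)
    (p2 p3 p4 p5 p6 : ℝ) : Prop where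
  meas : Measurable T
  int : ∀ k : ℕ, Integrable (fun ω => T ω ^ k) P
  m1 : ∫ ω, T ω ^ 1 ∂P = 0
  m2 : ∫ ω, T ω ^ 2 ∂P = 1 / 2 * p2
  m3 : ∫ ω, T ω ^ 3 ∂P = p3
  m4 : ∫ ω, T ω ^ 4 ∂P = 3 * p4 + 3 / 4 * p2 ^ 2
  m5 : ∫ ω, T ω ^ 5 ∂P = 12 * p5 + 5 * p2 * p3
  m6 : ∫ ω, T ω ^ 6 ∂P = 60 * p6 + 15 / 8 * p2 ^ 3 + 10 * p3 ^ 2 + 45 / 2 * (p2 * p4)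

lemma add_pow_indep {Ω : Type*} [MeasurableSpace Ω] {P : Measure Ω}
    {T X : Ω → ℝ} (hT : ∀ k : ℕ, Integrable (fun ω => T ω ^ k) P)
    (hX : ∀ k : ℕ, Integrable (fun ω => X ω ^ k) P) (h : IndepFun T X P) (k : ℕ) :
    Integrable (fun ω => (T ω + X ω) ^ k) P ∧
    ∫ ω, (T ω + X ω) ^ k ∂P = ∑ m ∈ Finset.range (k+1),
      (∫ ω, T ω ^ m ∂P) * (∫ ω, X ω ^ (k - m) ∂P) * (k.choose m) := by
  simp only [add_pow]
  have hi : ∀ m n : ℕ, IndepFun (fun ω => T ω ^ m) (fun ω => X ω ^ n) P := fun m n =>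
    h.comp (φ := fun x : ℝ => x ^ m) (ψ := fun x : ℝ => x ^ n) (by fun_prop) (by fun_prop)
  have hI : ∀ m n : ℕ, Integrable (fun ω => T ω ^ m * X ω ^ n) P := fun m n =>
    (hi m n).integrable_mul (hT m) (hX n)
  refine ⟨integrable_finsetSum _ fun m _ => (hI _ _).mul_const _, ?_⟩
  rw [integral_finsetSum _ fun m _ => (hI _ _).mul_const _]
  refine Finset.sum_congr rfl fun m _ => ?_
  rw [integral_mul_const]
  congr 1
  exact (hi _ _).integral_mul_eq_mul_integral (hT m).aestronglyMeasurable (hX _).aestronglyMeasurable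

lemma MomSix.add {Ω : Type*} [MeasurableSpace Ω] {P : Measure Ω} [IsProbabilityMeasure P]
    {T X : Ω → ℝ} {p2 p3 p4 p5 p6 q2 q3 q4 q5 q6 : ℝ}
    (hT : MomSix P T p2 p3 p4 p5 p6) (hX : MomSix P X q2 q3 q4 q5 q6) (h : IndepFun T X P) :
    MomSix P (fun ω => T ω + X ω) (p2 + q2) (p3 + q3) (p4 + q4) (p5 + q5) (p6 + q6) := by
  have key := fun k => (add_pow_indep hT.int hX.int h k).2
  have t0 : ∫ ω, T ω ^ 0 ∂P = 1 := by simp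
  have x0 : ∫ ω, X ω ^ 0 ∂P = 1 := by simp
  refine ⟨hT.meas.add hX.meas, fun k => (add_pow_indep hT.int hX.int h k).1, ?_, ?_, ?_, ?_, ?_, ?_⟩
  all_goals
    rw [key]
    simp only [Finset.sum_range_succ, Finset.sum_range_zero, Nat.sub_self, Nat.sub_zero,
      Nat.reduceSub, t0, x0, hT.m1, hT.m2, hT.m3, hT.m4, hT.m5, hT.m6,
      hX.m1, hX.m2, hX.m3, hX.m4, hX.m5, hX.m6]
    norm_num [Nat.choose]
    try ring

lemma momSix_single {d : ℕ} (b : ℝ) (i : Fin d) :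
    MomSix (Measure.pi (fun _ : Fin d => gaussianReal 0 1)) (fun x => b / 2 * (x i ^ 2 - 1))
      (b ^ 2) (b ^ 3) (b ^ 4) (b ^ 5) (b ^ 6) := by
  have mp := measurePreserving_eval (fun _ : Fin d => gaussianReal 0 1) i
  have hI : ∀ k : ℕ, ∫ x : Fin d → ℝ, (b / 2 * (x i ^ 2 - 1)) ^ k
      ∂(Measure.pi (fun _ : Fin d => gaussianReal 0 1)) =
      (b / 2) ^ k * ∫ y, (y ^ 2 - 1) ^ k ∂(gaussianReal 0 1) := by
    intro k
    rw [← integral_const_mul]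
    have := integral_map (μ := Measure.pi (fun _ : Fin d => gaussianReal 0 1))
      (φ := Function.eval i) (f := fun y : ℝ => (b / 2) ^ k * (y ^ 2 - 1) ^ k)
      mp.measurable.aemeasurable (by fun_prop)
    rw [mp.map_eq] at this
    rw [this]
    simp only [mul_pow, Function.eval]
  obtain ⟨z1, z2, z3, z4, z5, z6⟩ := zmoms
  refine ⟨by fun_prop, fun k => ?_, ?_, ?_, ?_, ?_, ?_, ?_⟩
  · simp only [mul_pow]
    refine Integrable.const_mul ?_ _
    exact mp.integrable_comp_of_integrable (zint k)
  all_goals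
    rw [hI]
    simp only [z1, z2, z3, z4, z5, z6]
    ring

lemma momSix_sum {d : ℕ} (b : Fin d → ℝ) (s : Finset (Fin d)) :
    MomSix (Measure.pi (fun _ : Fin d => gaussianReal 0 1))
      (fun x => ∑ i ∈ s, b i / 2 * (x i ^ 2 - 1))
      (∑ i ∈ s, b i ^ 2) (∑ i ∈ s, b i ^ 3) (∑ i ∈ s, b i ^ 4) (∑ i ∈ s, b i ^ 5)
      (∑ i ∈ s, b i ^ 6) := by
  classical
  induction s using Finset.induction_on with
  | empty =>
    refine ⟨by fun_prop, fun k => ?_, ?_, ?_, ?_, ?_, ?_, ?_⟩ <;> simp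
  | insert i s hi ih =>
    have hind : iIndepFun (fun (j : Fin d) (x : Fin d → ℝ) => b j / 2 * (x j ^ 2 - 1))
        (Measure.pi (fun _ : Fin d => gaussianReal 0 1)) :=
      iIndepFun_pi (X := fun j (y : ℝ) => b j / 2 * (y ^ 2 - 1)) (fun j => by fun_prop)
    have h2 := hind.indepFun_finsetSum_of_notMem (fun j => by fun_prop) hi
    have h3 : (∑ j ∈ s, fun (x : Fin d → ℝ) => b j / 2 * (x j ^ 2 - 1)) =
      fun x => ∑ j ∈ s, b j / 2 * (x j ^ 2 - 1) := by
      funext x; simp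
    rw [h3] at h2
    have := ih.add (momSix_single (b i) i) h2
    simp only [Finset.sum_insert hi]
    simpa only [add_comm] using this

/-- Rotation invariance. -/
lemma gaussLaw_rot {d : ℕ} (U : Matrix (Fin d) (Fin d) ℝ) (hU : U * Uᵀ = 1) :
    Measure.map (fun x => U *ᵥ x) (gaussLaw (1 : Matrix (Fin d) (Fin d) ℝ)) = gaussLaw 1 := by
  have hU' : Uᵀ * U = 1 := mul_eq_one_comm.1 hU
  have hdet : U.det ^ 2 = 1 := by
    have := congrArg Matrix.det hU
    rwa [det_mul, det_transpose, det_one, ← sq] at this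
  have hne : U.det ≠ 0 := by rintro h; simp [h] at hdet
  have habs : |U.det⁻¹| = 1 := by
    rw [abs_inv, inv_eq_one]
    rcases (show U.det = 1 ∨ U.det = -1 by simpa using hdet) with h | h <;> simp [h]
  have hvol := Real.map_matrix_volume_pi_eq_smul_volume_pi hne
  rw [habs] at hvol
  simp only [ENNReal.ofReal_one, one_smul] at hvol
  have hmeas : Measurable (fun x : Fin d → ℝ => U *ᵥ x) :=
    (Continuous.matrix_mulVec continuous_const continuous_id).measurable
  have hdm : Measurable (fun x => ENNReal.ofReal (gaussDensity (1 : Matrix (Fin d) (Fin d) ℝ) x)) := by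
    simp only [gaussDensity_one]
    have := measurable_gaussianPDFReal 0 1
    refine ENNReal.measurable_ofReal.comp (Finset.measurable_prod _ fun i _ => this.comp (measurable_pi_apply i))
  have hinv : ∀ x, gaussDensity (1 : Matrix (Fin d) (Fin d) ℝ) (U *ᵥ x) = gaussDensity 1 x := by
    intro x
    simp only [gaussDensity, inv_one, one_mulVec]
    rw [dotProduct_mulVec, vecMul_mulVec, hU', vecMul_one] 
  ext s hs
  rw [Measure.map_apply hmeas hs, gaussLaw, withDensity_apply _ (hmeas hs), withDensity_apply _ hs]
  conv_rhs => rw [← hvol]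
  rw [setLIntegral_map hs hdm (by exact hmeas)]
  refine lintegral_congr fun x => ?_
  rw [toLin'_apply, hinv]

lemma MomSix.comp {Ω Ω' : Type*} [MeasurableSpace Ω] [MeasurableSpace Ω'] {P : Measure Ω}
    {Q : Measure Ω'} {T : Ω' → ℝ} {f : Ω → Ω'} {p2 p3 p4 p5 p6 : ℝ}
    (h : MomSix Q T p2 p3 p4 p5 p6) (hf : Measurable f) (hm : Measure.map f P = Q) :
    MomSix P (fun ω => T (f ω)) p2 p3 p4 p5 p6 := by
  have hI : ∀ k : ℕ, ∫ ω, T (f ω) ^ k ∂P = ∫ x, T x ^ k ∂Q := by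
    intro k
    rw [← hm, integral_map hf.aemeasurable (h.meas.pow_const k).aestronglyMeasurable]
  refine ⟨h.meas.comp hf, fun k => ?_, ?_, ?_, ?_, ?_, ?_, ?_⟩
  · have := h.int k
    rw [← hm] at this
    exact this.comp_measurable hf
  all_goals rw [hI]
  exacts [h.m1, h.m2, h.m3, h.m4, h.m5, h.m6]

lemma spectral_exists {d : ℕ} {B : Matrix (Fin d) (Fin d) ℝ} (hB : B.IsHermitian) :
    ∃ (U : Matrix (Fin d) (Fin d) ℝ) (b : Fin d → ℝ), U * Uᵀ = 1 ∧ Uᵀ * U = 1 ∧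
      B = U * diagonal b * Uᵀ := by
  have h := hB.spectral_theorem
  have e : (star (hB.eigenvectorUnitary : Matrix (Fin d) (Fin d) ℝ)) =
    (hB.eigenvectorUnitary : Matrix (Fin d) (Fin d) ℝ)ᵀ := by
    rw [star_eq_conjTranspose, conjTranspose_eq_transpose_of_trivial]
  refine ⟨hB.eigenvectorUnitary, hB.eigenvalues, ?_, ?_, ?_⟩
  · rw [← e]; exact Unitary.mul_star_self_of_mem hB.eigenvectorUnitary.2
  · rw [← e]; exact Unitary.star_mul_self_of_mem hB.eigenvectorUnitary.2
  · rw [← e]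
    conv_lhs => rw [h]
    simp [Unitary.conjStarAlgAut_apply]

lemma trace_pow_spec {d : ℕ} {U : Matrix (Fin d) (Fin d) ℝ} {b : Fin d → ℝ}
    (hU : Uᵀ * U = 1) (k : ℕ) :
    trace ((U * diagonal b * Uᵀ) ^ k) = ∑ i, b i ^ k := by
  have : (U * diagonal b * Uᵀ) ^ k = U * diagonal (fun i => b i ^ k) * Uᵀ := by
    induction k with
    | zero => simp [mul_eq_one_comm.1 hU]
    | succ k ih =>
      rw [pow_succ, ih]
      calc _ = U * diagonal (fun i => b i ^ k) * (Uᵀ * U) * diagonal b * Uᵀ := by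
            simp only [Matrix.mul_assoc]
        _ = _ := by
            rw [hU, Matrix.mul_one, Matrix.mul_assoc U, diagonal_mul_diagonal]
            simp only [pow_succ]
  rw [this, trace_mul_comm, ← Matrix.mul_assoc, hU, Matrix.one_mul, trace_diagonal]

lemma quad_spec {d : ℕ} (U : Matrix (Fin d) (Fin d) ℝ) (b : Fin d → ℝ) (n : Fin d → ℝ) :
    n ⬝ᵥ (U * diagonal b * Uᵀ) *ᵥ n = ∑ i, b i * (Uᵀ *ᵥ n) i ^ 2 := by
  rw [← mulVec_mulVec, ← mulVec_mulVec, dotProduct_mulVec, ← mulVec_transpose]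
  simp only [dotProduct, mulVec_diagonal]
  exact Finset.sum_congr rfl fun i _ => by ring

/-- The moments of the centered Gaussian quadratic form. -/
lemma quadMom {d : ℕ} {B : Matrix (Fin d) (Fin d) ℝ} (hB : B.IsHermitian) :
    MomSix (gaussLaw 1) (fun n => 1 / 2 * (n ⬝ᵥ B *ᵥ n - trace B))
      (trace (B ^ 2)) (trace (B ^ 3)) (trace (B ^ 4)) (trace (B ^ 5)) (trace (B ^ 6)) := by
  obtain ⟨U, b, h1, h2, rfl⟩ := spectral_exists hB
  simp only [trace_pow_spec h2]
  have h := momSix_sum b Finset.univ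
  rw [← gaussLaw_one] at h
  have hm : Measurable (fun x : Fin d → ℝ => Uᵀ *ᵥ x) :=
    (Continuous.matrix_mulVec continuous_const continuous_id).measurable
  have h' := h.comp hm (gaussLaw_rot Uᵀ (by simpa using h2))
  have e : (fun n => 1 / 2 * (n ⬝ᵥ (U * diagonal b * Uᵀ) *ᵥ n - trace (U * diagonal b * Uᵀ))) =
      fun n => ∑ i, b i / 2 * ((Uᵀ *ᵥ n) i ^ 2 - 1) := by
    funext n
    have ht := trace_pow_spec (b := b) h2 1
    simp only [pow_one] at ht
    rw [quad_spec, ht, ← Finset.sum_sub_distrib, Finset.mul_sum]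
    exact Finset.sum_congr rfl fun i _ => by ring
  rw [e]
  exact h'

lemma hfun_eq {d : ℕ} {A K S : Matrix (Fin d) (Fin d) ℝ} {t : ℝ} (hK : K.PosDef)
    (hS : Sᵀ = S) (hdet : S.det ≠ 0) (hSS : S * S = Gam A K t)
    (hB : (S⁻¹ * (A - K) * S⁻¹).IsHermitian) (n : Fin d → ℝ) :
    hfun 1 A K t (S *ᵥ n) =
      1 / 2 * (n ⬝ᵥ (S⁻¹ * (A - K) * S⁻¹) *ᵥ n - trace (S⁻¹ * (A - K) * S⁻¹)) := by
  obtain ⟨U, b, h1, h2, hBe⟩ := spectral_exists hB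
  have hu : IsUnit S.det := isUnit_iff_ne_zero.2 hdet
  have hD : A - K = S * (U * diagonal b * Uᵀ) * S := by
    rw [← hBe]
    calc A - K = (S * S⁻¹) * (A - K) * (S⁻¹ * S) := by
          rw [mul_nonsing_inv _ hu, nonsing_inv_mul _ hu, Matrix.one_mul, Matrix.mul_one]
      _ = _ := by simp only [Matrix.mul_assoc]
  have hG : ∀ s, Gam A K s = S * (U * diagonal (fun i => 1 + (s - t) * b i) * Uᵀ) * S := by
    intro s
    have e1 : Gam A K s = Gam A K t + (s - t) • (A - K) := by
      simp only [Gam]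
      ext i j
      simp only [Matrix.add_apply, Matrix.smul_apply, Matrix.sub_apply, smul_eq_mul]
      ring
    have e2 : diagonal (fun i => 1 + (s - t) * b i) = 1 + (s - t) • diagonal b := by
      rw [← diagonal_one, ← diagonal_smul, diagonal_add]
      rfl
    rw [e1, ← hSS, hD, e2, Matrix.mul_add, Matrix.add_mul, Matrix.mul_add, Matrix.add_mul,
      Matrix.mul_one, h1, Matrix.mul_one]
    simp only [Matrix.mul_smul, Matrix.smul_mul]
  have hUd : U.det * U.det = 1 := by
    have := congrArg Matrix.det h1
    rwa [det_mul, det_transpose, det_one] at this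
  have hdetG : ∀ s, (Gam A K s).det = S.det ^ 2 * ∏ i, (1 + (s - t) * b i) := by
    intro s
    rw [hG, det_mul, det_mul, det_mul, det_mul, det_transpose, det_diagonal]
    linear_combination (S.det ^ 2 * ∏ i, (1 + (s - t) * b i)) * hUd
  set y := Uᵀ *ᵥ n with hy
  have hinv : ∀ s, (∀ i, 1 + (s - t) * b i ≠ 0) →
      (S *ᵥ n) ⬝ᵥ (Gam A K s)⁻¹ *ᵥ (S *ᵥ n) = ∑ i, (1 + (s - t) * b i)⁻¹ * y i ^ 2 := by
    intro s hs
    have e : (Gam A K s)⁻¹ = S⁻¹ * (U * diagonal (fun i => (1 + (s - t) * b i)⁻¹) * Uᵀ) * S⁻¹ := by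
      refine inv_eq_right_inv ?_
      rw [hG]
      calc _ = S * U * diagonal (fun i => 1 + (s - t) * b i) * (Uᵀ * (S * S⁻¹) * U) *
            diagonal (fun i => (1 + (s - t) * b i)⁻¹) * Uᵀ * S⁻¹ := by
              simp only [Matrix.mul_assoc]
        _ = S * U * (diagonal (fun i => 1 + (s - t) * b i) *
            diagonal (fun i => (1 + (s - t) * b i)⁻¹)) * Uᵀ * S⁻¹ := by
              rw [mul_nonsing_inv _ hu, Matrix.mul_one, h2, Matrix.mul_one]
              simp only [Matrix.mul_assoc]
        _ = S * (U * Uᵀ) * S⁻¹ := by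
              rw [diagonal_mul_diagonal]
              simp only [mul_inv_cancel₀ (hs _), diagonal_one, Matrix.mul_one, Matrix.mul_assoc]
        _ = 1 := by rw [h1, Matrix.mul_one, mul_nonsing_inv _ hu]
    rw [e, ← quad_spec, mulVec_mulVec, Matrix.mul_assoc, nonsing_inv_mul _ hu, Matrix.mul_one,
      ← mulVec_mulVec, dotProduct_mulVec, ← mulVec_transpose, transpose_nonsing_inv, hS,
      mulVec_mulVec, nonsing_inv_mul _ hu, one_mulVec]
  have hc : gaussDensity K (S *ᵥ n) ≠ 0 := by
    have := hK.det_pos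
    unfold gaussDensity
    positivity
  have hev : ∀ᶠ s in nhds t, ∀ i, 1 + (s - t) * b i ≠ 0 := by
    rw [Filter.eventually_all]
    intro i
    have : ContinuousAt (fun s : ℝ => 1 + (s - t) * b i) t := by fun_prop
    exact this.eventually_ne (by simp)
  have hgf : (fun s => gfun A K s (S *ᵥ n)) =ᶠ[nhds t] fun s =>
      (√((2 * Real.pi) ^ d * (S.det ^ 2 * ∏ i, (1 + (s - t) * b i))))⁻¹ *
        Real.exp (-(1/2) * ∑ i, (1 + (s - t) * b i)⁻¹ * y i ^ 2) / gaussDensity K (S *ᵥ n) := by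
    filter_upwards [hev] with s hs
    simp only [gfun]
    congr 1
    rw [gaussDensity, hdetG, hinv s hs]
  have hl : ∀ i, HasDerivAt (fun s : ℝ => 1 + (s - t) * b i) (b i) t := by
    intro i
    simpa using (((hasDerivAt_id t).sub_const t).mul_const (b i)).const_add 1
  have hP : HasDerivAt (fun s : ℝ => ∏ i, (1 + (s - t) * b i)) (∑ i, b i) t := by
    have := HasDerivAt.fun_finsetProd (u := Finset.univ) (fun i _ => hl i)
    simpa using this
  have hQ : HasDerivAt (fun s : ℝ => ∑ i, (1 + (s - t) * b i)⁻¹ * y i ^ 2)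
      (∑ i, -(b i) * y i ^ 2) t := by
    refine HasDerivAt.fun_sum fun i _ => ?_
    have := ((hl i).fun_inv (by simp)).mul_const (y i ^ 2)
    simpa using this
  have hCpos : 0 < (2 * Real.pi) ^ d * S.det ^ 2 := by positivity
  have hsq := ((((hP.const_mul (S.det ^ 2)).const_mul ((2 * Real.pi) ^ d)).sqrt
    (by simp; exact hdet)).fun_inv (by simp; positivity))
  have hall := (hsq.mul ((hQ.const_mul (-(1/2))).exp)).div_const (gaussDensity K (S *ᵥ n))
  have hfin := (hall.congr_of_eventuallyEq hgf).deriv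
  have hval := hgf.eq_of_nhds
  simp only [hfun, iteratedDeriv_one]
  rw [hfin, hval, hBe, quad_spec]
  have ht := trace_pow_spec (b := b) h2 1
  simp only [pow_one] at ht
  rw [ht]
  simp only [sub_self, zero_mul, add_zero, Finset.prod_const_one, mul_one, inv_one, one_mul,
    neg_mul, Finset.sum_neg_distrib, ← hy]
  have hsp : √((2 * Real.pi) ^ d * S.det ^ 2) ^ 2 = (2 * Real.pi) ^ d * S.det ^ 2 :=
    Real.sq_sqrt hCpos.le
  have hs0 : √((2 * Real.pi) ^ d * S.det ^ 2) ≠ 0 := (Real.sqrt_pos.2 hCpos).ne'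
  set C := (2 * Real.pi) ^ d * S.det ^ 2 with hC
  rw [← mul_assoc, ← hC]
  field_simp
  rw [hsp]
  field_simp
  ring

instance matMeasurableSpace {d : ℕ} : MeasurableSpace (Matrix (Fin d) (Fin d) ℝ) :=
  inferInstanceAs (MeasurableSpace (Fin d → Fin d → ℝ))

instance matBorelSpace {d : ℕ} : BorelSpace (Matrix (Fin d) (Fin d) ℝ) :=
  inferInstanceAs (BorelSpace (Fin d → Fin d → ℝ))

instance matPolishSpace {d : ℕ} : PolishSpace (Matrix (Fin d) (Fin d) ℝ) :=
  inferInstanceAs (PolishSpace (Fin d → Fin d → ℝ))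

instance matSecond {d : ℕ} : SecondCountableTopology (Matrix (Fin d) (Fin d) ℝ) :=
  inferInstanceAs (SecondCountableTopology (Fin d → Fin d → ℝ))

lemma isClosed_herm {d : ℕ} : IsClosed {M : Matrix (Fin d) (Fin d) ℝ | M.IsHermitian} := by
  simp only [IsHermitian]
  exact isClosed_eq continuous_id.matrix_conjTranspose continuous_id

lemma isClosed_psd {d : ℕ} : IsClosed {M : Matrix (Fin d) (Fin d) ℝ | M.PosSemidef} := by
  simp only [posSemidef_iff_dotProduct_mulVec, Set.ofPred_and, Set.ofPred_forall]
  refine isClosed_herm.inter (isClosed_iInter fun x => isClosed_le continuous_const ?_)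
  exact continuous_const.dotProduct (continuous_id.matrix_mulVec continuous_const)

open scoped MatrixOrder in
lemma psd_sqrt_unique {d : ℕ} {X Y : Matrix (Fin d) (Fin d) ℝ} (hX : X.PosSemidef)
    (hY : Y.PosSemidef) (h : X * X = Y * Y) : X = Y := by
  have h1 := CFC.sqrt_unique (a := X * X) (b := X) rfl hX.nonneg
  have h2 := CFC.sqrt_unique (a := X * X) (b := Y) h.symm hY.nonneg
  rw [← h1, h2]

lemma measurable_psd_sqrt {Ω : Type*} {m : MeasurableSpace Ω} {d : ℕ}
    {S : Ω → Matrix (Fin d) (Fin d) ℝ} (hS : ∀ ω, (S ω).PosSemidef)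
    (hSS : Measurable fun ω => S ω * S ω) : Measurable S := by
  let PS := {M : Matrix (Fin d) (Fin d) ℝ | M.PosSemidef}
  have : PolishSpace PS := isClosed_psd.polishSpace
  let f : PS → Matrix (Fin d) (Fin d) ℝ := fun M => M.1 * M.1
  have hf : Continuous f := continuous_subtype_val.matrix_mul continuous_subtype_val
  have hinj : Function.Injective f := fun X Y h => Subtype.ext (psd_sqrt_unique X.2 Y.2 h)
  have he := hf.measurableEmbedding hinj
  have : Measurable (fun ω => (⟨S ω, hS ω⟩ : PS)) := (he.measurable_comp_iff).1 hSS
  exact measurable_subtype_coe.comp this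

lemma measurable_matmul {Ω : Type*} {m : MeasurableSpace Ω} {d : ℕ}
    {X Y : Ω → Matrix (Fin d) (Fin d) ℝ} (hX : Measurable X) (hY : Measurable Y) :
    Measurable fun ω => X ω * Y ω :=
  (continuous_fst.matrix_mul continuous_snd).measurable.comp (hX.prodMk hY)

lemma measurable_matinv {Ω : Type*} {m : MeasurableSpace Ω} {d : ℕ}
    {X : Ω → Matrix (Fin d) (Fin d) ℝ} (hX : Measurable X) :
    Measurable fun ω => (X ω)⁻¹ := by
  simp only [inv_def, Ring.inverse_eq_inv']
  have h1 : Measurable fun ω => ((X ω).det)⁻¹ :=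
    ((continuous_id.matrix_det (R := ℝ)).measurable.comp hX).inv
  have h2 : Measurable fun ω => (X ω).adjugate :=
    (continuous_id.matrix_adjugate (R := ℝ)).measurable.comp hX
  exact (continuous_fst.smul continuous_snd).measurable.comp (h1.prodMk h2)

lemma measurable_trace_pow {d : ℕ} (k : ℕ) :
    Measurable fun M : Matrix (Fin d) (Fin d) ℝ => trace (M ^ k) :=
  ((continuous_id.pow k).matrix_trace).measurable

/-! Euclidean norm, the sphere and the event. -/

lemma continuous_eucl {d : ℕ} : Continuous (euclNorm : (Fin d → ℝ) → ℝ) := by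
  unfold euclNorm
  fun_prop

lemma eucl_nonneg {d : ℕ} (x : Fin d → ℝ) : 0 ≤ euclNorm x := Real.sqrt_nonneg _

lemma abs_le_eucl {d : ℕ} (x : Fin d → ℝ) (i : Fin d) : |x i| ≤ euclNorm x := by
  unfold euclNorm
  rw [← Real.sqrt_sq_eq_abs]
  exact Real.sqrt_le_sqrt (Finset.single_le_sum (f := fun i => x i ^ 2) (fun j _ => sq_nonneg _)
    (Finset.mem_univ i))

lemma abs_dot_le {d : ℕ} (x y : Fin d → ℝ) : |x ⬝ᵥ y| ≤ euclNorm x * euclNorm y := by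
  unfold euclNorm dotProduct
  rw [← Real.sqrt_mul (Finset.sum_nonneg fun i _ => sq_nonneg _), ← Real.sqrt_sq_eq_abs]
  exact Real.sqrt_le_sqrt (Finset.sum_mul_sq_le_sq_mul_sq _ _ _)

lemma isCompact_sphere' {d : ℕ} : IsCompact {x : Fin d → ℝ | euclNorm x = 1} := by
  refine Metric.isCompact_of_isClosed_isBounded (isClosed_eq continuous_eucl continuous_const) ?_
  refine (Metric.isBounded_closedBall (x := (0 : Fin d → ℝ)) (r := 1)).subset fun x hx => ?_
  rw [mem_closedBall_zero_iff, pi_norm_le_iff_of_nonneg zero_le_one]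
  intro i
  exact (abs_le_eucl x i).trans (le_of_eq hx)

lemma eucl_single {d : ℕ} (i : Fin d) : euclNorm (Pi.single i (1:ℝ)) = 1 := by
  unfold euclNorm
  simp [Pi.single_apply]

lemma eucl_ne_zero {d : ℕ} {v : Fin d → ℝ} (hv : v ≠ 0) : 0 < euclNorm v := by
  obtain ⟨i, hi⟩ := Function.ne_iff.1 hv
  exact (abs_pos.2 hi).trans_le (abs_le_eucl v i)

lemma eucl_smul {d : ℕ} (c : ℝ) (v : Fin d → ℝ) : euclNorm (c • v) = |c| * euclNorm v := by
  unfold euclNorm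
  simp only [Pi.smul_apply, smul_eq_mul, mul_pow, ← Finset.mul_sum]
  rw [Real.sqrt_mul (sq_nonneg _), Real.sqrt_sq_eq_abs]

lemma lambdaMin_spec {d : ℕ} (hd : 1 ≤ d) {K : Matrix (Fin d) (Fin d) ℝ} (hK : K.PosDef) :
    0 < lambdaMin K ∧ ∀ x, euclNorm x = 1 → lambdaMin K ≤ x ⬝ᵥ K *ᵥ x := by
  have hset : {r : ℝ | ∃ x : Fin d → ℝ, euclNorm x = 1 ∧ r = x ⬝ᵥ K.mulVec x} =
      (fun x : Fin d → ℝ => x ⬝ᵥ K *ᵥ x) '' {x | euclNorm x = 1} := by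
    ext r; constructor
    · rintro ⟨x, hx, rfl⟩; exact ⟨x, hx, rfl⟩
    · rintro ⟨x, hx, rfl⟩; exact ⟨x, hx, rfl⟩
  have hcont : Continuous (fun x : Fin d → ℝ => x ⬝ᵥ K *ᵥ x) :=
    continuous_id.dotProduct (continuous_const.matrix_mulVec continuous_id)
  have hc := isCompact_sphere'.image hcont
  have hne : ((fun x : Fin d → ℝ => x ⬝ᵥ K *ᵥ x) '' {x | euclNorm x = 1}).Nonempty :=
    ⟨_, Pi.single ⟨0, hd⟩ 1, eucl_single _, rfl⟩
  unfold lambdaMin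
  rw [hset]
  constructor
  · obtain ⟨x, hx, hxe⟩ := hc.sInf_mem hne
    rw [← hxe]
    have hx0 : x ≠ 0 := by
      rintro rfl
      simp [euclNorm] at hx
    simpa using hK.dotProduct_mulVec_pos hx0
  · intro x hx
    exact csInf_le hc.bddBelow ⟨x, hx, rfl⟩

lemma opNorm_le_iff {d : ℕ} (hd : 1 ≤ d) (M : Matrix (Fin d) (Fin d) ℝ) (c : ℝ) :
    opNorm M ≤ c ↔ ∀ x, euclNorm x = 1 → euclNorm (M *ᵥ x) ≤ c := by
  have hset : {r : ℝ | ∃ x : Fin d → ℝ, euclNorm x = 1 ∧ r = euclNorm (M.mulVec x)} =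
      (fun x : Fin d → ℝ => euclNorm (M *ᵥ x)) '' {x | euclNorm x = 1} := by
    ext r; constructor
    · rintro ⟨x, hx, rfl⟩; exact ⟨x, hx, rfl⟩
    · rintro ⟨x, hx, rfl⟩; exact ⟨x, hx, rfl⟩
  have hcont : Continuous (fun x : Fin d → ℝ => euclNorm (M *ᵥ x)) :=
    continuous_eucl.comp (continuous_const.matrix_mulVec continuous_id)
  have hc := isCompact_sphere'.image hcont
  have hne : ((fun x : Fin d → ℝ => euclNorm (M *ᵥ x)) '' {x | euclNorm x = 1}).Nonempty :=
    ⟨_, Pi.single ⟨0, hd⟩ 1, eucl_single _, rfl⟩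
  unfold opNorm
  rw [hset, csSup_le_iff hc.bddAbove hne]
  simp

/-- The set of matrices defining the event. -/
def goodSet {d : ℕ} (K : Matrix (Fin d) (Fin d) ℝ) : Set (Matrix (Fin d) (Fin d) ℝ) :=
  {M | opNorm (M - K) ≤ lambdaMin K / 2}

lemma isClosed_goodSet {d : ℕ} (hd : 1 ≤ d) (K : Matrix (Fin d) (Fin d) ℝ) :
    IsClosed (goodSet K) := by
  simp only [goodSet, opNorm_le_iff hd, Set.ofPred_forall]
  refine isClosed_iInter fun x => isClosed_iInter fun _ => isClosed_le ?_ continuous_const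
  exact continuous_eucl.comp ((continuous_id.sub continuous_const).matrix_mulVec continuous_const)

lemma isCompact_goodSet {d : ℕ} (hd : 1 ≤ d) {K : Matrix (Fin d) (Fin d) ℝ} (hK : K.PosDef) :
    IsCompact (goodSet K) := by
  have hb : goodSet K ⊆ (Metric.closedBall (α := Fin d → Fin d → ℝ) K (lambdaMin K / 2)) := by
    intro M hM
    have h0 : 0 ≤ lambdaMin K / 2 := by linarith [(lambdaMin_spec hd hK).1]
    refine (Metric.mem_closedBall (α := Fin d → Fin d → ℝ)).2 ((dist_pi_le_iff h0).2 fun i =>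
      (dist_pi_le_iff h0).2 fun j => ?_)
    have := (opNorm_le_iff hd _ _).1 hM (Pi.single j 1) (eucl_single j)
    have h2 := (abs_le_eucl _ i).trans this
    rw [mulVec_single_one] at h2
    rw [Real.dist_eq]
    exact h2
  exact (isCompact_closedBall (α := Fin d → Fin d → ℝ) K (lambdaMin K / 2)).of_isClosed_subset
    (isClosed_goodSet hd K) hb

lemma gam_det_ne {d : ℕ} (hd : 1 ≤ d) {K M : Matrix (Fin d) (Fin d) ℝ} (hK : K.PosDef)
    (hM : M ∈ goodSet K) {t : ℝ} (ht : t ∈ Set.Icc (0:ℝ) 1) : (Gam M K t).det ≠ 0 := by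
  intro h
  obtain ⟨v, hv, hv0⟩ := exists_mulVec_eq_zero_iff.2 h
  obtain ⟨hl, hl2⟩ := lambdaMin_spec hd hK
  have hp := eucl_ne_zero hv
  set x := (euclNorm v)⁻¹ • v with hx
  have hx1 : euclNorm x = 1 := by
    rw [hx, eucl_smul, abs_of_pos (by positivity), inv_mul_cancel₀ hp.ne']
  have hx0 : Gam M K t *ᵥ x = 0 := by rw [hx, mulVec_smul, hv0, smul_zero]
  have e : Gam M K t = K + t • (M - K) := by
    simp only [Gam, smul_sub, sub_smul, one_smul]
    abel
  have h1 : x ⬝ᵥ K *ᵥ x + t * (x ⬝ᵥ (M - K) *ᵥ x) = 0 := by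
    rw [e, add_mulVec, smul_mulVec] at hx0
    have := congrArg (fun z => x ⬝ᵥ z) hx0
    simpa only [dotProduct_add, dotProduct_smul, smul_eq_mul, dotProduct_zero] using this
  have h2 := abs_dot_le x ((M - K) *ᵥ x)
  rw [hx1, one_mul] at h2
  have h3 := h2.trans ((opNorm_le_iff hd _ _).1 hM x hx1)
  have h4 := hl2 x hx1
  have h5 := (abs_le.1 h3).1
  nlinarith [ht.1, ht.2]

lemma trace_bdd {d : ℕ} (hd : 1 ≤ d) {K : Matrix (Fin d) (Fin d) ℝ} (hK : K.PosDef)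
    {t : ℝ} (ht : t ∈ Set.Icc (0:ℝ) 1) (k : ℕ) :
    ∃ C, ∀ M ∈ goodSet K, |trace (((Gam M K t)⁻¹ * (M - K)) ^ k)| ≤ C := by
  have hG : Continuous fun M : Matrix (Fin d) (Fin d) ℝ => Gam M K t := by
    unfold Gam; fun_prop
  have hinv : ContinuousOn (fun M : Matrix (Fin d) (Fin d) ℝ => (Gam M K t)⁻¹) (goodSet K) := by
    simp only [inv_def, Ring.inverse_eq_inv']
    exact (hG.matrix_det.continuousOn.inv₀ fun M hM => gam_det_ne hd hK hM ht).smul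
      hG.matrix_adjugate.continuousOn
  have hc : ContinuousOn (fun M : Matrix (Fin d) (Fin d) ℝ =>
      trace (((Gam M K t)⁻¹ * (M - K)) ^ k)) (goodSet K) := by
    have h1 : ContinuousOn (fun M : Matrix (Fin d) (Fin d) ℝ => ((Gam M K t)⁻¹ * (M - K)) ^ k)
        (goodSet K) := (hinv.mul (continuous_id.sub continuous_const).continuousOn).pow k
    exact (continuous_id.matrix_trace (R := ℝ)).comp_continuousOn h1
  obtain ⟨C, hC⟩ := (isCompact_goodSet hd hK).exists_bound_of_continuousOn hc
  exact ⟨C, hC⟩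

instance gaussLaw_prob {d : ℕ} : IsProbabilityMeasure (gaussLaw (1 : Matrix (Fin d) (Fin d) ℝ)) := by
  rw [gaussLaw_one]; infer_instance

/-- The quadratic form. -/
noncomputable def qf {d : ℕ} (B : Matrix (Fin d) (Fin d) ℝ) (n : Fin d → ℝ) : ℝ :=
  1 / 2 * (n ⬝ᵥ B *ᵥ n - trace B)

lemma fubini_aux {d : ℕ} {Ω : Type*} [MeasurableSpace Ω] (P : Measure Ω) [IsProbabilityMeasure P]
    {N : Ω → Fin d → ℝ} (hN : Measure.map N P = gaussLaw (1 : Matrix (Fin d) (Fin d) ℝ))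
    {B : Ω → Matrix (Fin d) (Fin d) ℝ} (hBm : Measurable B) (hB : ∀ ω, (B ω).IsHermitian)
    (hI : IndepFun N B P) {k : ℕ} (hk : Even k) (ρ : Matrix (Fin d) (Fin d) ℝ → ℝ)
    (hρm : Measurable ρ) (hρ : ∀ b : Matrix (Fin d) (Fin d) ℝ, b.IsHermitian →
      ∫ n, qf b n ^ k ∂(gaussLaw 1) = ρ b) (hint : Integrable (fun ω => ρ (B ω)) P) :
    ∫ ω, qf (B ω) (N ω) ^ k ∂P = ∫ ω, ρ (B ω) ∂P := by
  have hNm : AEMeasurable N P := by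
    by_contra h
    rw [Measure.map_of_not_aemeasurable h] at hN
    exact (IsProbabilityMeasure.ne_zero (gaussLaw (1 : Matrix (Fin d) (Fin d) ℝ))) hN.symm
  have hj := (indepFun_iff_map_prod_eq_prod_map_map hBm.aemeasurable hNm).1 hI.symm
  rw [hN] at hj
  have hqc : Continuous fun p : Matrix (Fin d) (Fin d) ℝ × (Fin d → ℝ) => qf p.1 p.2 ^ k := by
    unfold qf
    have h1 : Continuous fun p : Matrix (Fin d) (Fin d) ℝ × (Fin d → ℝ) => p.2 ⬝ᵥ p.1 *ᵥ p.2 :=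
      continuous_snd.dotProduct (continuous_fst.matrix_mulVec continuous_snd)
    have h2 : Continuous fun p : Matrix (Fin d) (Fin d) ℝ × (Fin d → ℝ) => trace p.1 :=
      continuous_fst.matrix_trace
    exact (continuous_const.mul (h1.sub h2)).pow k
  have : IsProbabilityMeasure (Measure.map B P) := Measure.isProbabilityMeasure_map hBm.aemeasurable
  have hae : ∀ᵐ b ∂(Measure.map B P), b.IsHermitian :=
    (ae_map_iff hBm.aemeasurable isClosed_herm.measurableSet).2 (ae_of_all _ hB)
  have hρint : Integrable ρ (Measure.map B P) :=
    (integrable_map_measure hρm.aestronglyMeasurable hBm.aemeasurable).2 hint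
  have hInt : Integrable (fun p : Matrix (Fin d) (Fin d) ℝ × (Fin d → ℝ) => qf p.1 p.2 ^ k)
      ((Measure.map B P).prod (gaussLaw 1)) := by
    rw [integrable_prod_iff hqc.measurable.aestronglyMeasurable]
    constructor
    · filter_upwards [hae] with b hb
      exact (quadMom hb).int k
    · refine hρint.congr ?_
      filter_upwards [hae] with b hb
      rw [← hρ b hb]
      refine integral_congr_ae (ae_of_all _ fun n => ?_)
      exact (abs_of_nonneg (hk.pow_nonneg (qf b n))).symm
  calc ∫ ω, qf (B ω) (N ω) ^ k ∂P
      = ∫ p, qf p.1 p.2 ^ k ∂(Measure.map (fun ω => (B ω, N ω)) P) :=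
        (integral_map (hBm.aemeasurable.prodMk hNm) hqc.measurable.aestronglyMeasurable).symm
    _ = ∫ b, ∫ n, qf b n ^ k ∂(gaussLaw 1) ∂(Measure.map B P) := by
        rw [hj, integral_prod _ hInt]
    _ = ∫ b, ρ b ∂(Measure.map B P) := by
        refine integral_congr_ae ?_
        filter_upwards [hae] with b hb
        exact hρ b hb
    _ = ∫ ω, ρ (B ω) ∂P := integral_map hBm.aemeasurable hρm.aestronglyMeasurable

lemma trace_conj_pow {d : ℕ} {S D : Matrix (Fin d) (Fin d) ℝ} (hS : S.det ≠ 0) (k : ℕ) :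
    trace (((S * S)⁻¹ * D) ^ k) = trace ((S⁻¹ * D * S⁻¹) ^ k) := by
  have hu : IsUnit S.det := isUnit_iff_ne_zero.2 hS
  have h : ((S * S)⁻¹ * D) ^ k * S⁻¹ = S⁻¹ * (S⁻¹ * D * S⁻¹) ^ k := by
    induction k with
    | zero => simp
    | succ k ih =>
      rw [pow_succ', pow_succ', Matrix.mul_assoc, ih, Matrix.mul_inv_rev]
      simp only [Matrix.mul_assoc]
  have h2 : ((S * S)⁻¹ * D) ^ k = S⁻¹ * (S⁻¹ * D * S⁻¹) ^ k * S := by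
    rw [← h, Matrix.mul_assoc, nonsing_inv_mul _ hu, Matrix.mul_one]
  rw [h2, trace_mul_comm, ← Matrix.mul_assoc, mul_nonsing_inv _ hu, Matrix.one_mul]

/-- Lemma `mom_sec_h`, moments of `h₁`: second, fourth and sixth moments of
`h₁(A,t,F_t)` on the event `E`. -/
theorem statement_11
    {d : ℕ} (hd : 1 ≤ d)
    {Ω : Type*} [mΩ : MeasurableSpace Ω] (P : Measure Ω) [IsProbabilityMeasure P]
    (K : Matrix (Fin d) (Fin d) ℝ) (hK : K.PosDef)
    (A : Ω → Matrix (Fin d) (Fin d) ℝ) (hA : ∀ ω, (A ω).PosSemidef)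
    (hAmeas : Measurable fun ω i j => A ω i j)
    (hA8 : Integrable (fun ω => hsNorm (A ω) ^ 8) P)
    (N : Ω → Fin d → ℝ) (hN : Measure.map N P = gaussLaw (1 : Matrix (Fin d) (Fin d) ℝ))
    (hInd : IndepFun N (fun ω i j => A ω i j) P)
    (t : ℝ) (ht : t ∈ Set.Icc (0 : ℝ) 1)
    (S : Ω → Matrix (Fin d) (Fin d) ℝ)
    (hS : ∀ ω, (S ω).PosSemidef ∧ S ω * S ω = Gam (A ω) K t) :
    ((∫ ω in EvSet A K, hfun 1 (A ω) K t ((S ω).mulVec (N ω)) ^ 2 ∂P) =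
      (1 / 2) * ∫ ω in EvSet A K,
        Matrix.trace (((Gam (A ω) K t)⁻¹ * (A ω - K)) ^ 2) ∂P) ∧
    ((∫ ω in EvSet A K, hfun 1 (A ω) K t ((S ω).mulVec (N ω)) ^ 4 ∂P) =
      3 * (∫ ω in EvSet A K,
        Matrix.trace (((Gam (A ω) K t)⁻¹ * (A ω - K)) ^ 4) ∂P)
      + (3 / 4) * ∫ ω in EvSet A K,
          Matrix.trace (((Gam (A ω) K t)⁻¹ * (A ω - K)) ^ 2) ^ 2 ∂P) ∧
    ((∫ ω in EvSet A K, hfun 1 (A ω) K t ((S ω).mulVec (N ω)) ^ 6 ∂P) =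
      60 * (∫ ω in EvSet A K,
        Matrix.trace (((Gam (A ω) K t)⁻¹ * (A ω - K)) ^ 6) ∂P)
      + (15 / 8) * (∫ ω in EvSet A K,
          Matrix.trace (((Gam (A ω) K t)⁻¹ * (A ω - K)) ^ 2) ^ 3 ∂P)
      + 10 * (∫ ω in EvSet A K,
          Matrix.trace (((Gam (A ω) K t)⁻¹ * (A ω - K)) ^ 3) ^ 2 ∂P)
      + (45 / 2) * ∫ ω in EvSet A K,
          Matrix.trace (((Gam (A ω) K t)⁻¹ * (A ω - K)) ^ 2) *
            Matrix.trace (((Gam (A ω) K t)⁻¹ * (A ω - K)) ^ 4) ∂P) := by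
  classical
  have hAm : Measurable A := hAmeas
  have hle : MeasurableSpace.comap A matMeasurableSpace ≤ mΩ := hAm.comap_le
  have hAA : Measurable[MeasurableSpace.comap A matMeasurableSpace] A := comap_measurable A
  have hGm : Measurable[MeasurableSpace.comap A matMeasurableSpace] (fun ω => Gam (A ω) K t) := by
    have hc : Continuous fun M : Matrix (Fin d) (Fin d) ℝ => Gam M K t := by
      unfold Gam; fun_prop
    exact hc.measurable.comp hAA
  have hSm : Measurable[MeasurableSpace.comap A matMeasurableSpace] S :=
    measurable_psd_sqrt (fun ω => (hS ω).1) (by simpa only [(hS _).2] using hGm)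
  have hEm : MeasurableSet[MeasurableSpace.comap A matMeasurableSpace] (EvSet A K) :=
    hAA (isClosed_goodSet hd K).measurableSet
  let B : Ω → Matrix (Fin d) (Fin d) ℝ :=
    fun ω => if ω ∈ EvSet A K then (S ω)⁻¹ * (A ω - K) * (S ω)⁻¹ else 0
  have hDm : Measurable[MeasurableSpace.comap A matMeasurableSpace] (fun ω => A ω - K) :=
    (continuous_id.sub continuous_const).measurable.comp hAA
  have hBA : Measurable[MeasurableSpace.comap A matMeasurableSpace] B :=
    Measurable.ite hEm (measurable_matmul (measurable_matmul (measurable_matinv hSm) hDm)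
      (measurable_matinv hSm)) measurable_const
  have hBm : Measurable B := hBA.mono hle le_rfl
  have hInd' : IndepFun N B P := by
    rw [IndepFun_iff_Indep] at hInd ⊢
    exact indep_of_indep_of_le_right hInd hBA.comap_le
  have hSt : ∀ ω, (S ω)ᵀ = S ω := fun ω => by
    have := (hS ω).1.isHermitian
    rwa [IsHermitian, conjTranspose_eq_transpose_of_trivial] at this
  have hherm : ∀ ω, ((S ω)⁻¹ * (A ω - K) * (S ω)⁻¹).IsHermitian := by
    intro ω
    have hD : (A ω - K)ᴴ = A ω - K := ((hA ω).isHermitian.sub hK.isHermitian)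
    have hSi : ((S ω)⁻¹)ᴴ = (S ω)⁻¹ := (hS ω).1.isHermitian.inv
    rw [IsHermitian, conjTranspose_mul, conjTranspose_mul, hD, hSi, Matrix.mul_assoc]
  have hBh : ∀ ω, (B ω).IsHermitian := by
    intro ω
    simp only [B]
    split_ifs
    · exact hherm ω
    · exact isHermitian_zero
  have hdet : ∀ ω ∈ EvSet A K, (S ω).det ≠ 0 := by
    intro ω hω h
    have h1 := gam_det_ne hd hK (M := A ω) hω ht
    rw [← (hS ω).2, det_mul, h, zero_mul] at h1
    exact h1 rfl
  have hBon : ∀ ω ∈ EvSet A K, B ω = (S ω)⁻¹ * (A ω - K) * (S ω)⁻¹ := fun ω hω => if_pos hω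
  have hBoff : ∀ ω ∉ EvSet A K, B ω = 0 := fun ω hω => if_neg hω
  have htr : ∀ (k : ℕ), ∀ ω ∈ EvSet A K,
      trace (((Gam (A ω) K t)⁻¹ * (A ω - K)) ^ k) = trace (B ω ^ k) := by
    intro k ω hω
    rw [hBon ω hω, ← (hS ω).2, trace_conj_pow (hdet ω hω)]
  have hbd : ∀ k : ℕ, ∃ C, ∀ ω, |trace (B ω ^ k)| ≤ C := by
    intro k
    obtain ⟨C, hC⟩ := trace_bdd hd hK ht k
    refine ⟨max C |trace ((0 : Matrix (Fin d) (Fin d) ℝ) ^ k)|, fun ω => ?_⟩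
    by_cases hω : ω ∈ EvSet A K
    · rw [← htr k ω hω]
      exact (hC (A ω) hω).trans (le_max_left _ _)
    · rw [hBoff ω hω]
      exact le_max_right _ _
  have htm : ∀ k : ℕ, Measurable fun ω => trace (B ω ^ k) := fun k =>
    (measurable_trace_pow k).comp hBm
  -- bounded products are integrable
  have hmemLp : ∀ k : ℕ, MemLp (fun ω => trace (B ω ^ k)) ⊤ P := by
    intro k
    obtain ⟨C, hC⟩ := hbd k
    exact memLp_top_of_bound (htm k).aestronglyMeasurable C (ae_of_all _ hC)
  have hmul : ∀ {f g : Ω → ℝ}, MemLp f ⊤ P → MemLp g ⊤ P → MemLp (fun ω => f ω * g ω) ⊤ P :=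
    fun hf hg => hg.mul hf
  have hInt : ∀ {f : Ω → ℝ}, MemLp f ⊤ P → Integrable f P := fun hf => hf.integrable le_top
  have hl : ∀ k : ℕ, k ≠ 0 → ∫ ω in EvSet A K, hfun 1 (A ω) K t ((S ω).mulVec (N ω)) ^ k ∂P =
      ∫ ω, qf (B ω) (N ω) ^ k ∂P := by
    intro k hk
    rw [← setIntegral_eq_integral_of_forall_compl_eq_zero (s := EvSet A K)
      (f := fun ω => qf (B ω) (N ω) ^ k)]
    · refine setIntegral_congr_fun (hle _ hEm) fun ω hω => ?_
      rw [hfun_eq hK (hSt ω) (hdet ω hω) (hS ω).2 (hherm ω), ← hBon ω hω]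
      rfl
    · intro ω hω
      rw [hBoff ω hω]
      simp [qf, hk]
  have hr : ∀ (f : Matrix (Fin d) (Fin d) ℝ → ℝ) (g : Ω → ℝ), f 0 = 0 →
      (∀ ω ∈ EvSet A K, g ω = f (B ω)) → ∫ ω in EvSet A K, g ω ∂P = ∫ ω, f (B ω) ∂P := by
    intro f g hf hg
    rw [← setIntegral_eq_integral_of_forall_compl_eq_zero (s := EvSet A K)
      (f := fun ω => f (B ω))]
    · exact setIntegral_congr_fun (hle _ hEm) hg
    · intro ω hω
      rw [hBoff ω hω, hf]
  have i2 := hInt (hmemLp 2)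
  have i4 := hInt (hmemLp 4)
  have i6 := hInt (hmemLp 6)
  have i22 : Integrable (fun ω => trace (B ω ^ 2) ^ 2) P := by
    simpa only [← sq] using hInt (hmul (hmemLp 2) (hmemLp 2))
  have i33 : Integrable (fun ω => trace (B ω ^ 3) ^ 2) P := by
    simpa only [← sq] using hInt (hmul (hmemLp 3) (hmemLp 3))
  have i222 : Integrable (fun ω => trace (B ω ^ 2) ^ 3) P := by
    simpa only [← sq, ← pow_succ] using hInt (hmul (hmul (hmemLp 2) (hmemLp 2)) (hmemLp 2))
  have i24 := hInt (hmul (hmemLp 2) (hmemLp 4))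
  have m := fun k : ℕ => measurable_trace_pow (d := d) k
  have j1 : Integrable (fun ω => 60 * trace (B ω ^ 6) + 15 / 8 * trace (B ω ^ 2) ^ 3) P :=
    (i6.const_mul _).add (i222.const_mul _)
  have j2 : Integrable (fun ω => 60 * trace (B ω ^ 6) + 15 / 8 * trace (B ω ^ 2) ^ 3 +
      10 * trace (B ω ^ 3) ^ 2) P := j1.add (i33.const_mul _)
  refine ⟨?_, ?_, ?_⟩
  · rw [hl 2 (by norm_num), hr (fun b => trace (b ^ 2)) _ (by simp) (htr 2),
      fubini_aux P hN hBm hBh hInd' (by decide) (fun b => 1 / 2 * trace (b ^ 2))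
        ((m 2).const_mul _) (fun b hb => (quadMom hb).m2) (i2.const_mul _),
      integral_const_mul]
  · rw [hl 4 (by norm_num), hr (fun b => trace (b ^ 4)) _ (by simp) (htr 4),
      hr (fun b => trace (b ^ 2) ^ 2) _ (by simp) (fun ω hω => by rw [htr 2 ω hω]),
      fubini_aux P hN hBm hBh hInd' (by decide)
        (fun b => 3 * trace (b ^ 4) + 3 / 4 * trace (b ^ 2) ^ 2)
        (((m 4).const_mul _).add (((m 2).pow_const 2).const_mul _))
        (fun b hb => (quadMom hb).m4) ((i4.const_mul _).add (i22.const_mul _)),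
      integral_add (i4.const_mul _) (i22.const_mul _), integral_const_mul, integral_const_mul]
  · rw [hl 6 (by norm_num), hr (fun b => trace (b ^ 6)) _ (by simp) (htr 6),
      hr (fun b => trace (b ^ 2) ^ 3) _ (by simp) (fun ω hω => by rw [htr 2 ω hω]),
      hr (fun b => trace (b ^ 3) ^ 2) _ (by simp) (fun ω hω => by rw [htr 3 ω hω]),
      hr (fun b => trace (b ^ 2) * trace (b ^ 4)) _ (by simp)
        (fun ω hω => by rw [htr 2 ω hω, htr 4 ω hω]),
      fubini_aux P hN hBm hBh hInd' (by decide)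
        (fun b => 60 * trace (b ^ 6) + 15 / 8 * trace (b ^ 2) ^ 3 + 10 * trace (b ^ 3) ^ 2 +
          45 / 2 * (trace (b ^ 2) * trace (b ^ 4)))
        (((((m 6).const_mul _).add (((m 2).pow_const 3).const_mul _)).add
          (((m 3).pow_const 2).const_mul _)).add (((m 2).mul (m 4)).const_mul _))
        (fun b hb => (quadMom hb).m6)
        (j2.add (i24.const_mul _)),
      integral_add j2 (i24.const_mul _), integral_add j1 (i33.const_mul _),
      integral_add (i6.const_mul _) (i222.const_mul _),
      integral_const_mul, integral_const_mul, integral_const_mul, integral_const_mul]
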